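/- (Multi-dimensional Cauchy identity, equation (3.2) of the paper) Let r ≥ 1 be an integer, let q ∈ ℂ with 0 < |q| < 1, and let a_1, …, a_r ∈ ℂ with |a_j| < 1 for all j. Then 1 / [(a_1 q;q)_∞ (a_2 q;q)_∞ ⋯ (a_r q;q)_∞] = 1 + Σ_{N=1}^∞ q^{N²} [∏_{j=1}^{r} 1/(a_j q;q)_{N-1}] · Σ_{i_1+⋯+i_r=N, i_t ≥ 0} [a_1^{i_1}⋯a_r^{i_r} / ((q;q)_{i_1}⋯(q;q)_{i_r})] · (1 + Σ_{s=1}^{r} q^{i_1+i_2+⋯+i_{s-1}} · [a_s q^N / (1 - a_s q^N)] · ∏_{k=1}^{s-1} 1/(1 - a_k q^N)), where the inner sum ranges over all r-tuples (i_1,…,i_r) of nonnegative integers summing to N and the outer series converges absolutely. -/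

import Mathlib

/-- The finite q-Pochhammer symbol `(a;q)_n = ∏_{k=0}^{n-1} (1 - a q^k)`. -/
noncomputable def qPoch (a q : ℂ) (n : ℕ) : ℂ := ∏ k ∈ Finset.range n, (1 - a * q ^ k)

/-- The infinite q-Pochhammer symbol `(a;q)_∞ = ∏_{k=0}^∞ (1 - a q^k)`. -/
noncomputable def qPochInf (a q : ℂ) : ℂ := ∏' k : ℕ, (1 - a * q ^ k)

/-- The `N`-th summand in the multi-dimensional Cauchy identity (equation (3.2)). -/
noncomputable def cauchyTerm (r : ℕ) (q : ℂ) (a : Fin r → ℂ) (N : ℕ) : ℂ :=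
  q ^ (N ^ 2) * (∏ j : Fin r, 1 / qPoch (a j * q) q (N - 1)) *
    ∑ i ∈ Finset.Nat.antidiagonalTuple r N,
      ((∏ t : Fin r, a t ^ i t) / ∏ t : Fin r, qPoch q q (i t)) *
        (1 + ∑ s : Fin r, q ^ (∑ t ∈ Finset.Iio s, i t) *
            (a s * q ^ N / (1 - a s * q ^ N)) *
            ∏ k ∈ Finset.Iio s, 1 / (1 - a k * q ^ N))

open Filter Topology Finset

theorem one_sub_mul_pow_ne_zero {a q : ℂ} (ha : ‖a‖ ≤ 1) (hq : ‖q‖ < 1) {n : ℕ} (hn : n ≠ 0) :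
    1 - a * q ^ n ≠ 0 := by
  intro h
  have h1 : ‖a * q ^ n‖ = 1 := by rw [← sub_eq_zero.1 h, norm_one]
  have h2 : ‖a * q ^ n‖ < 1 := by
    rw [norm_mul, norm_pow]
    exact mul_lt_one_of_nonneg_of_lt_one_right ha (by positivity)
      (pow_lt_one₀ (norm_nonneg _) hq hn)
  exact h2.ne h1

theorem qPoch_succ (a q : ℂ) (n : ℕ) :
    qPoch (a * q) q (n + 1) = qPoch (a * q) q n * (1 - a * q ^ (n + 1)) := by
  rw [qPoch, prod_range_succ, qPoch, pow_succ' q n, mul_assoc]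

theorem summable_norm_mul_pow (a : ℂ) {q : ℂ} (hq : ‖q‖ < 1) :
    Summable fun k : ℕ ↦ ‖-(a * q ^ k)‖ := by
  simp only [norm_neg, norm_mul, norm_pow]
  exact (summable_geometric_of_lt_one (norm_nonneg _) hq).mul_left _

theorem tendsto_qPoch (a : ℂ) {q : ℂ} (hq : ‖q‖ < 1) :
    Tendsto (qPoch a q) atTop (𝓝 (qPochInf a q)) := by
  have h := (multipliable_one_add_of_summable (summable_norm_mul_pow a hq)).tendsto_prod_tprod_nat
  simp only [← sub_eq_add_neg] at h
  exact h

theorem qPochInf_mul_ne_zero {a q : ℂ} (ha : ‖a‖ ≤ 1) (hq : ‖q‖ < 1) :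
    qPochInf (a * q) q ≠ 0 := by
  have h := tprod_one_add_ne_zero_of_summable (f := fun k : ℕ ↦ -(a * q * q ^ k))
    (fun k ↦ by
      rw [← sub_eq_add_neg, mul_assoc, ← pow_succ']
      exact one_sub_mul_pow_ne_zero ha hq k.succ_ne_zero) (summable_norm_mul_pow _ hq)
  simp only [← sub_eq_add_neg] at h
  exact h

/-- The coefficient of `z ^ k` in `∏ t, 1 / (a t * z * q ^ [t < s]; q)_∞`. -/
noncomputable def shiftedCoeff (r : ℕ) (q : ℂ) (a : Fin r → ℂ) (s k : ℕ) : ℂ :=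
  ∑ i ∈ Nat.antidiagonalTuple r k,
    ((∏ t, a t ^ i t) / ∏ t, qPoch q q (i t)) * q ^ ∑ t with t.val < s, i t

theorem filter_val_lt_succ {r : ℕ} (s : Fin r) :
    (univ.filter fun t : Fin r ↦ t.val < s.val + 1) =
      insert s (univ.filter fun t : Fin r ↦ t.val < s.val) := by
  ext t
  simp only [mem_filter, mem_univ, true_and, mem_insert, Fin.ext_iff]
  omega

theorem shiftedCoeff_zero (r : ℕ) (q : ℂ) (a : Fin r → ℂ) (s : ℕ) :
    shiftedCoeff r q a s 0 = 1 := by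
  simp [shiftedCoeff, Nat.antidiagonalTuple_zero_right, qPoch]

theorem sum_antidiagonalTuple_succ {r : ℕ} {M : Type*} [AddCommMonoid M] (s : Fin r) (k : ℕ)
    (f : (Fin r → ℕ) → M) (hf : ∀ i, i s = 0 → f i = 0) :
    ∑ i ∈ Nat.antidiagonalTuple r (k + 1), f i =
      ∑ j ∈ Nat.antidiagonalTuple r k, f (Function.update j s (j s + 1)) := by
  rw [← sum_filter_of_ne (p := fun i ↦ i s ≠ 0) fun i _ h h0 ↦ h (hf i h0)]
  symm
  refine sum_nbij' (fun j ↦ Function.update j s (j s + 1))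
    (fun i ↦ Function.update i s (i s - 1)) ?_ ?_ ?_ ?_ fun _ _ ↦ rfl
  · intro j hj
    rw [Nat.mem_antidiagonalTuple, ← add_sum_erase _ _ (mem_univ s)] at hj
    rw [mem_filter, Nat.mem_antidiagonalTuple, sum_update_of_mem (mem_univ s),
      sdiff_singleton_eq_erase]
    refine ⟨by omega, by simp⟩
  · intro i hi
    rw [mem_filter, Nat.mem_antidiagonalTuple, ← add_sum_erase _ _ (mem_univ s)] at hi
    rw [Nat.mem_antidiagonalTuple, sum_update_of_mem (mem_univ s), sdiff_singleton_eq_erase]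
    omega
  · intro j _
    simp
  · intro i hi
    rw [mem_filter] at hi
    simp [Nat.sub_add_cancel (Nat.pos_of_ne_zero hi.2)]

theorem prod_pow_div_prod_qPoch_update {r : ℕ} {q : ℂ} (hq : ‖q‖ < 1) (a : Fin r → ℂ)
    (s : Fin r) (j : Fin r → ℕ) :
    ((∏ t, a t ^ Function.update j s (j s + 1) t) /
        ∏ t, qPoch q q (Function.update j s (j s + 1) t)) * (1 - q ^ (j s + 1)) =
      a s * ((∏ t, a t ^ j t) / ∏ t, qPoch q q (j t)) := by
  have h1 : 1 - q ^ (j s + 1) ≠ 0 := by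
    simpa using one_sub_mul_pow_ne_zero (a := 1) (by simp) hq (j s).succ_ne_zero
  have h2 : qPoch q q (j s + 1) = qPoch q q (j s) * (1 - q ^ (j s + 1)) := by
    simpa using qPoch_succ 1 q (j s)
  have h3 : ∀ t ∈ univ.erase s, a t ^ Function.update j s (j s + 1) t /
      qPoch q q (Function.update j s (j s + 1) t) = a t ^ j t / qPoch q q (j t) := by
    intro t ht
    rw [Function.update_of_ne (ne_of_mem_erase ht)]
  rw [← prod_div_distrib, ← prod_div_distrib, ← mul_prod_erase _ _ (mem_univ s), prod_congr rfl h3,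
    ← mul_prod_erase univ (fun t ↦ a t ^ j t / qPoch q q (j t)) (mem_univ s),
    Function.update_self, h2, pow_succ' (a s), mul_div_mul_comm]
  field_simp

theorem shiftedCoeff_succ {r : ℕ} {q : ℂ} (hq : ‖q‖ < 1) (a : Fin r → ℂ) (s : Fin r) (k : ℕ) :
    shiftedCoeff r q a (s + 1) (k + 1) =
      shiftedCoeff r q a s (k + 1) - a s * shiftedCoeff r q a s k := by
  rw [eq_sub_iff_add_eq', ← eq_sub_iff_add_eq, shiftedCoeff, shiftedCoeff, shiftedCoeff,
    ← sum_sub_distrib, mul_sum, sum_antidiagonalTuple_succ s]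
  · refine sum_congr rfl fun j _ ↦ ?_
    have h : ∑ t with t.val < s.val, Function.update j s (j s + 1) t =
        ∑ t with t.val < s.val, j t := by
      refine sum_congr rfl fun t ht ↦ Function.update_of_ne ?_ _ _
      rintro rfl
      simp at ht
    rw [filter_val_lt_succ, sum_insert (by simp), h, Function.update_self, ← mul_assoc,
      ← prod_pow_div_prod_qPoch_update hq, pow_add]
    ring
  · intro i h0
    rw [filter_val_lt_succ, sum_insert (by simp), h0, zero_add, sub_self]

/-- The polynomial in `w` obtained by truncating `∑ k, shiftedCoeff r q a s k * w ^ k`. -/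
noncomputable def truncatedSeries (r : ℕ) (q : ℂ) (a : Fin r → ℂ) (s N : ℕ) (w : ℂ) : ℂ :=
  ∑ k ∈ range (N + 1), shiftedCoeff r q a s k * w ^ k

theorem truncatedSeries_succ {r : ℕ} {q : ℂ} (hq : ‖q‖ < 1) (a : Fin r → ℂ) (s : Fin r)
    (N : ℕ) (w : ℂ) :
    truncatedSeries r q a (s + 1) N w = (1 - a s * w) * truncatedSeries r q a s N w +
      a s * w ^ (N + 1) * shiftedCoeff r q a s N := by
  have h : truncatedSeries r q a s N w =
      ∑ k ∈ range N, shiftedCoeff r q a s k * w ^ k + shiftedCoeff r q a s N * w ^ N :=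
    sum_range_succ _ _
  have h' : truncatedSeries r q a s N w =
      ∑ k ∈ range N, shiftedCoeff r q a s (k + 1) * w ^ (k + 1) + 1 := by
    rw [truncatedSeries, sum_range_succ', shiftedCoeff_zero, pow_zero, mul_one]
  have h'' : truncatedSeries r q a (s + 1) N w =
      truncatedSeries r q a s N w - a s * w * ∑ k ∈ range N, shiftedCoeff r q a s k * w ^ k := by
    rw [h', truncatedSeries, sum_range_succ', shiftedCoeff_zero, mul_sum, add_sub_right_comm,
      ← sum_sub_distrib, pow_zero, mul_one]
    congr 1
    refine sum_congr rfl fun k _ ↦ ?_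
    rw [shiftedCoeff_succ hq]
    ring
  rw [h'']
  linear_combination (a s * w) * h

theorem truncatedSeries_mul_prod {r : ℕ} {q w : ℂ} (hq : ‖q‖ < 1) (a : Fin r → ℂ)
    (hw : ∀ t, 1 - a t * w ≠ 0) (N s : ℕ) (hs : s ≤ r) :
    truncatedSeries r q a s N w * ∏ t : Fin r with t.val < s, 1 / (1 - a t * w) =
      truncatedSeries r q a 0 N w + w ^ N * ∑ t : Fin r with t.val < s, shiftedCoeff r q a t N *
        (a t * w / (1 - a t * w)) * ∏ k ∈ Iio t, 1 / (1 - a k * w) := by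
  induction s with
  | zero => simp
  | succ s ih =>
    have e : (Iio (⟨s, hs⟩ : Fin r)) = univ.filter fun t : Fin r ↦ t.val < s := by
      ext t; simp [Fin.lt_def (b := ⟨s, hs⟩)]
    have h := truncatedSeries_succ hq a ⟨s, hs⟩ N w
    have hf := filter_val_lt_succ (⟨s, hs⟩ : Fin r)
    simp only at h hf
    rw [h, hf, prod_insert (by simp), sum_insert (by simp), mul_add, add_left_comm,
      ← ih (by omega), e]
    have := hw ⟨s, hs⟩
    simp only
    field_simp
    ring

theorem cauchyTerm_eq (r : ℕ) (q : ℂ) (a : Fin r → ℂ) (N : ℕ) :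
    cauchyTerm r q a N = (∏ j, 1 / qPoch (a j * q) q (N - 1)) * (q ^ N) ^ N *
      (shiftedCoeff r q a 0 N + ∑ t : Fin r, shiftedCoeff r q a t N *
        (a t * q ^ N / (1 - a t * q ^ N)) * ∏ k ∈ Iio t, 1 / (1 - a k * q ^ N)) := by
  have e (s : Fin r) : Iio s = univ.filter fun t : Fin r ↦ t.val < s.val := by
    ext t; simp
  rw [cauchyTerm, ← pow_mul, ← sq, mul_comm (q ^ N ^ 2)]
  congr 1
  simp only [mul_add, sum_add_distrib, shiftedCoeff, sum_mul, e]
  rw [sum_comm]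
  simp [mul_sum, mul_assoc]

theorem truncatedSeries_top (r : ℕ) (q : ℂ) (a : Fin r → ℂ) (N : ℕ) (w : ℂ) :
    truncatedSeries r q a r N w = truncatedSeries r q a 0 N (q * w) := by
  refine sum_congr rfl fun k _ ↦ ?_
  rw [shiftedCoeff, shiftedCoeff, mul_pow, ← mul_assoc, sum_mul _ _ (q ^ k)]
  congr 1
  refine sum_congr rfl fun i hi ↦ ?_
  rw [Nat.mem_antidiagonalTuple] at hi
  simp [hi]

theorem one_add_sum_cauchyTerm {r : ℕ} {q : ℂ} (hq : ‖q‖ < 1) (a : Fin r → ℂ)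
    (ha : ∀ j, ‖a j‖ ≤ 1) (N : ℕ) :
    1 + ∑ n ∈ range N, cauchyTerm r q a (n + 1) =
      (∏ j, 1 / qPoch (a j * q) q N) * truncatedSeries r q a 0 N (q ^ (N + 1)) := by
  induction N with
  | zero => simp [qPoch, truncatedSeries, shiftedCoeff_zero]
  | succ N ih =>
    have h := truncatedSeries_mul_prod hq a
      (fun t ↦ one_sub_mul_pow_ne_zero (ha t) hq N.succ_ne_zero) (N + 1) r le_rfl
    have e : (univ.filter fun t : Fin r ↦ t.val < r) = univ := by simp
    have h0 : truncatedSeries r q a 0 (N + 1) (q ^ (N + 1)) =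
        truncatedSeries r q a 0 N (q ^ (N + 1)) +
          shiftedCoeff r q a 0 (N + 1) * (q ^ (N + 1)) ^ (N + 1) := sum_range_succ _ _
    have hp : ∏ j, 1 / qPoch (a j * q) q (N + 1) =
        (∏ j, 1 / qPoch (a j * q) q N) * ∏ j, 1 / (1 - a j * q ^ (N + 1)) := by
      rw [← prod_mul_distrib]
      refine prod_congr rfl fun j _ ↦ ?_
      rw [qPoch_succ, one_div_mul_one_div]
    rw [truncatedSeries_top, ← pow_succ', e] at h
    rw [sum_range_succ, ← add_assoc, ih, cauchyTerm_eq, hp, Nat.add_sub_cancel]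
    simp only [Nat.succ_eq_add_one] at h
    linear_combination (-∏ j, 1 / qPoch (a j * q) q N) * (h + h0)

theorem tendsto_one_div_qPoch {a q : ℂ} (ha : ‖a‖ ≤ 1) (hq : ‖q‖ < 1) :
    Tendsto (fun n ↦ 1 / qPoch (a * q) q n) atTop (𝓝 (1 / qPochInf (a * q) q)) :=
  tendsto_const_nhds.div (tendsto_qPoch (a * q) hq) (qPochInf_mul_ne_zero ha hq)

theorem exists_norm_one_div_qPoch_le {a q : ℂ} (ha : ‖a‖ ≤ 1) (hq : ‖q‖ < 1) :
    ∃ C : ℝ, 1 ≤ C ∧ ∀ n, ‖1 / qPoch (a * q) q n‖ ≤ C := by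
  obtain ⟨C, hC⟩ := (Metric.isBounded_range_of_tendsto _ (tendsto_one_div_qPoch ha hq)).exists_norm_le
  exact ⟨max 1 C, le_max_left _ _, fun n ↦ (hC _ ⟨n, rfl⟩).trans (le_max_right _ _)⟩

theorem card_antidiagonalTuple_le (r k : ℕ) :
    (Nat.antidiagonalTuple r k).card ≤ (k + 1) ^ r := by
  have h : Nat.antidiagonalTuple r k ⊆ Fintype.piFinset fun _ ↦ range (k + 1) := by
    intro i hi
    rw [Nat.mem_antidiagonalTuple] at hi
    rw [Fintype.mem_piFinset]
    intro t
    have := single_le_sum (f := i) (fun _ _ ↦ Nat.zero_le _) (mem_univ t)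
    rw [mem_range]
    omega
  simpa using card_le_card h

theorem exists_norm_shiftedCoeff_le {r : ℕ} {q : ℂ} (hq : ‖q‖ < 1) (a : Fin r → ℂ)
    (ha : ∀ j, ‖a j‖ ≤ 1) :
    ∃ C : ℝ, 0 ≤ C ∧ ∀ s k, ‖shiftedCoeff r q a s k‖ ≤ C * (k + 1) ^ r := by
  obtain ⟨C, hC1, hC⟩ := exists_norm_one_div_qPoch_le (a := 1) (by simp) hq
  rw [one_mul] at hC
  refine ⟨C ^ r, by positivity, fun s k ↦ ?_⟩
  have h : ∀ i ∈ Nat.antidiagonalTuple r k, ‖((∏ t, a t ^ i t) / ∏ t, qPoch q q (i t)) *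
      q ^ ∑ t with t.val < s, i t‖ ≤ C ^ r := by
    intro i _
    rw [← prod_div_distrib, norm_mul, norm_prod, norm_pow]
    refine (mul_le_of_le_one_right (by positivity)
      (pow_le_one₀ (norm_nonneg _) hq.le)).trans ?_
    refine (prod_le_prod (g := fun _ ↦ C) (fun _ _ ↦ norm_nonneg _) fun t _ ↦ ?_).trans_eq (by simp)
    rw [← mul_one_div, norm_mul, norm_pow]
    exact (mul_le_of_le_one_left (norm_nonneg _) (pow_le_one₀ (norm_nonneg _) (ha t))).trans
      (hC _)
  refine (norm_sum_le_of_le _ h).trans ?_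
  rw [sum_const, nsmul_eq_mul, mul_comm]
  gcongr
  exact_mod_cast card_antidiagonalTuple_le r k

theorem summable_succ_pow_mul_geometric (r : ℕ) {x : ℝ} (hx0 : 0 < x) (hx : x < 1) :
    Summable fun k : ℕ ↦ ((k : ℝ) + 1) ^ r * x ^ k := by
  have h := (summable_nat_add_iff 1).2 (summable_pow_mul_geometric_of_norm_lt_one r
    (r := x) (by rwa [Real.norm_of_nonneg hx0.le]))
  refine (h.mul_right x⁻¹).congr fun k ↦ ?_
  push_cast
  field_simp
  ring

theorem tendsto_truncatedSeries {r : ℕ} {q : ℂ} (hq0 : 0 < ‖q‖) (hq : ‖q‖ < 1) (a : Fin r → ℂ)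
    (ha : ∀ j, ‖a j‖ ≤ 1) :
    Tendsto (fun N ↦ truncatedSeries r q a 0 N (q ^ (N + 1))) atTop (𝓝 1) := by
  obtain ⟨C, hC0, hC⟩ := exists_norm_shiftedCoeff_le hq a ha
  have hs := (summable_succ_pow_mul_geometric r hq0 hq).mul_left C
  rw [tendsto_iff_norm_sub_tendsto_zero]
  set M := ∑' k : ℕ, C * (((k : ℝ) + 1) ^ r * ‖q‖ ^ k)
  refine squeeze_zero (fun _ ↦ norm_nonneg _) (g := fun N ↦ ‖q‖ ^ N * M) (fun N ↦ ?_) ?_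
  · have h1 : truncatedSeries r q a 0 N (q ^ (N + 1)) - 1 =
        ∑ k ∈ range N, shiftedCoeff r q a 0 (k + 1) * (q ^ (N + 1)) ^ (k + 1) := by
      rw [truncatedSeries, sum_range_succ', shiftedCoeff_zero]
      simp
    have h2 : ∀ k ∈ range N, ‖shiftedCoeff r q a 0 (k + 1) * (q ^ (N + 1)) ^ (k + 1)‖ ≤
        ‖q‖ ^ N * (C * ((((k + 1 : ℕ) : ℝ) + 1) ^ r * ‖q‖ ^ (k + 1))) := by
      intro k _
      rw [norm_mul, norm_pow, norm_pow, ← pow_mul]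
      calc _ ≤ C * (((k + 1 : ℕ) : ℝ) + 1) ^ r * ‖q‖ ^ (N + (k + 1)) := by
            refine mul_le_mul (hC _ _) (pow_le_pow_of_le_one (norm_nonneg _) hq.le ?_)
              (by positivity) (by positivity)
            nlinarith [Nat.zero_le (N * k)]
        _ = _ := by ring
    rw [h1]
    refine (norm_sum_le_of_le _ h2).trans ?_
    rw [← mul_sum]
    gcongr
    refine le_trans ?_ (hs.sum_le_tsum (range (N + 1)) fun _ _ ↦ by positivity)
    rw [sum_range_succ']
    exact le_add_of_nonneg_right (by positivity)
  · simpa using (tendsto_pow_atTop_nhds_zero_of_lt_one (norm_nonneg _) hq).mul_const M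

theorem norm_one_div_one_sub_mul_pow_le {a q : ℂ} (ha : ‖a‖ ≤ 1) (hq : ‖q‖ < 1) {n : ℕ}
    (hn : n ≠ 0) : ‖1 / (1 - a * q ^ n)‖ ≤ 1 / (1 - ‖q‖) := by
  have h : ‖a * q ^ n‖ ≤ ‖q‖ := by
    rw [norm_mul, norm_pow]
    exact (mul_le_of_le_one_left (by positivity) ha).trans
      (pow_le_of_le_one (norm_nonneg _) hq.le hn)
  have h' := norm_sub_norm_le 1 (a * q ^ n)
  rw [norm_one] at h'
  rw [norm_div, norm_one]
  exact one_div_le_one_div_of_le (by linarith) (by linarith)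

theorem summable_norm_cauchyTerm {r : ℕ} {q : ℂ} (hq0 : 0 < ‖q‖) (hq : ‖q‖ < 1) (a : Fin r → ℂ)
    (ha : ∀ j, ‖a j‖ ≤ 1) : Summable fun N ↦ ‖cauchyTerm r q a (N + 1)‖ := by
  obtain ⟨C, hC0, hC⟩ := exists_norm_shiftedCoeff_le hq a ha
  choose K hK1 hK using fun j ↦ exists_norm_one_div_qPoch_le (ha j) hq
  have hK0 (j) : 0 ≤ K j := zero_le_one.trans (hK1 j)
  have hD1 : 1 ≤ 1 / (1 - ‖q‖) := by
    rw [le_div_iff₀ (by linarith)]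
    linarith
  set D := 1 / (1 - ‖q‖)
  have hs := (summable_nat_add_iff 1).2 (summable_succ_pow_mul_geometric r hq0 hq)
  refine Summable.of_nonneg_of_le (fun _ ↦ norm_nonneg _) (fun N ↦ ?_)
    (hs.mul_left ((∏ j, K j) * C * (1 + ∑ t : Fin r, D * D ^ (Iio t).card)))
  set n := N + 1
  have hn : n ≠ 0 := N.succ_ne_zero
  have hP : ‖∏ j, 1 / qPoch (a j * q) q (n - 1)‖ ≤ ∏ j, K j := by
    rw [norm_prod]
    exact prod_le_prod (fun _ _ ↦ norm_nonneg _) fun j _ ↦ hK j _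
  have hQ : ‖(q ^ n) ^ n‖ ≤ ‖q‖ ^ n := by
    rw [norm_pow, norm_pow]
    exact pow_le_of_le_one (by positivity) (pow_le_one₀ (norm_nonneg _) hq.le) hn
  have hT (t : Fin r) : ‖shiftedCoeff r q a t n * (a t * q ^ n / (1 - a t * q ^ n)) *
      ∏ k ∈ Iio t, 1 / (1 - a k * q ^ n)‖ ≤ C * (n + 1) ^ r * (D * D ^ (Iio t).card) := by
    rw [mul_assoc, norm_mul, norm_mul, norm_prod]
    refine mul_le_mul (hC _ _) (mul_le_mul ?_ ?_ (by positivity) (by positivity))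
      (by positivity) (by positivity)
    · rw [← mul_one_div, norm_mul, norm_mul, norm_pow]
      exact (mul_le_of_le_one_left (norm_nonneg _) (mul_le_one₀ (ha t) (by positivity)
        (pow_le_one₀ (norm_nonneg _) hq.le))).trans (norm_one_div_one_sub_mul_pow_le (ha t) hq hn)
    · exact (prod_le_prod (fun _ _ ↦ norm_nonneg _) fun k _ ↦
        norm_one_div_one_sub_mul_pow_le (ha k) hq hn).trans_eq (by rw [prod_const])
  have hB := norm_add_le_of_le (hC 0 n) (norm_sum_le_of_le univ fun t _ ↦ hT t)
  rw [cauchyTerm_eq, norm_mul, norm_mul]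
  have hKp : 0 ≤ ∏ j, K j := prod_nonneg fun j _ ↦ hK0 j
  refine (mul_le_mul (mul_le_mul hP hQ (norm_nonneg _) hKp) hB (norm_nonneg _)
    (by positivity)).trans_eq ?_
  rw [← mul_sum]
  ring

/-- The multi-dimensional Cauchy identity (equation (3.2) of the paper). -/
theorem multidimensional_cauchy (r : ℕ) (hr : 1 ≤ r) (q : ℂ)
    (hq0 : 0 < ‖q‖) (hq : ‖q‖ < 1) (a : Fin r → ℂ) (ha : ∀ j, ‖a j‖ < 1) :
    Summable (fun N : ℕ => ‖cauchyTerm r q a (N + 1)‖) ∧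
    1 / (∏ j : Fin r, qPochInf (a j * q) q) = 1 + ∑' N : ℕ, cauchyTerm r q a (N + 1) := by
  have ha' (j) : ‖a j‖ ≤ 1 := (ha j).le
  have hs := summable_norm_cauchyTerm hq0 hq a ha'
  refine ⟨hs, ?_⟩
  have h1 := hs.of_norm.hasSum.tendsto_sum_nat.const_add 1
  have h2 : Tendsto (fun N ↦ ∏ j, 1 / qPoch (a j * q) q N) atTop
      (𝓝 (∏ j, 1 / qPochInf (a j * q) q)) :=
    tendsto_finsetProd _ fun j _ ↦ tendsto_one_div_qPoch (ha' j) hq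
  have h3 := h2.mul (tendsto_truncatedSeries hq0 hq a ha')
  simp only [← one_add_sum_cauchyTerm hq a ha'] at h3
  rw [tendsto_nhds_unique h1 h3, prod_div_distrib, prod_const_one, mul_one]
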